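/- For every continuous self-dual antinorm f on the positive orthant ℝ^d₊, the antisphere {x ∈ ℝ^d₊ : f(x) = 1} intersects the Euclidean unit sphere {x : |x| = 1} in exactly one point. -/

import Mathlib

open scoped BigOperators

noncomputable section

/-- The positive orthant in Euclidean space `ℝ^d`. -/
def pos (d : ℕ) : Set (EuclideanSpace ℝ (Fin d)) := {x | ∀ i, 0 ≤ x i}

/-- Euclidean inner product of two vectors. -/
def dot {d : ℕ} (p x : EuclideanSpace ℝ (Fin d)) : ℝ := ∑ i, p i * x i

/-- An antinorm on the positive orthant: nonnegative, positively homogeneous,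
concave and strictly positive somewhere. -/
def IsAntinorm {d : ℕ} (f : EuclideanSpace ℝ (Fin d) → ℝ) : Prop :=
  (∀ x ∈ pos d, 0 ≤ f x) ∧
  (∀ x ∈ pos d, ∀ l : ℝ, 0 ≤ l → f (l • x) = l * f x) ∧
  ConcaveOn ℝ (pos d) f ∧
  ∃ x ∈ pos d, 0 < f x

/-- The dual antinorm `f*(p) = inf {⟨p,x⟩/f(x) : x ∈ ℝ^d₊, f(x) ≠ 0}`. -/
def dualAntinorm {d : ℕ} (f : EuclideanSpace ℝ (Fin d) → ℝ)
    (p : EuclideanSpace ℝ (Fin d)) : ℝ :=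
  sInf ((fun x => dot p x / f x) '' {x | x ∈ pos d ∧ f x ≠ 0})

/-- `dot` is the Euclidean inner product. -/
theorem dot_eq_inner {d : ℕ} (p x : EuclideanSpace ℝ (Fin d)) : dot p x = inner ℝ p x := by
  simp [dot, PiLp.inner_apply, mul_comm]

theorem isClosed_pos (d : ℕ) : IsClosed (pos d) := by
  simp only [pos, Set.ofPred_forall]
  exact isClosed_iInter fun i => isClosed_le continuous_const (by fun_prop)

theorem smul_mem_pos {d : ℕ} {x : EuclideanSpace ℝ (Fin d)} (hx : x ∈ pos d) {l : ℝ}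
    (hl : 0 ≤ l) : l • x ∈ pos d :=
  fun i => mul_nonneg hl (hx i)

theorem dot_nonneg {d : ℕ} {p x : EuclideanSpace ℝ (Fin d)} (hp : p ∈ pos d) (hx : x ∈ pos d) :
    0 ≤ dot p x :=
  Finset.sum_nonneg fun i _ => mul_nonneg (hp i) (hx i)

/-- The Fenchel-type inequality `f*(p) f(x) ≤ ⟨p, x⟩`. -/
theorem dualAntinorm_mul_le_dot {d : ℕ} {f : EuclideanSpace ℝ (Fin d) → ℝ} (hf : IsAntinorm f)
    {p x : EuclideanSpace ℝ (Fin d)} (hp : p ∈ pos d) (hx : x ∈ pos d) :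
    dualAntinorm f p * f x ≤ dot p x := by
  rcases (hf.1 x hx).eq_or_lt with h0 | hpos
  · simpa [← h0] using dot_nonneg hp hx
  · rw [← le_div_iff₀ hpos]
    refine csInf_le ⟨0, ?_⟩ ⟨x, ⟨hx, hpos.ne'⟩, rfl⟩
    rintro _ ⟨y, ⟨hy, -⟩, rfl⟩
    exact div_nonneg (dot_nonneg hp hy) (hf.1 y hy)

/-- An antinorm takes the value `1` at the radial rescaling of any point where it is nonzero. -/
theorem IsAntinorm.apply_inv_smul {d : ℕ} {f : EuclideanSpace ℝ (Fin d) → ℝ} (hf : IsAntinorm f)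
    {x : EuclideanSpace ℝ (Fin d)} (hx : x ∈ pos d) (h : f x ≠ 0) : f ((f x)⁻¹ • x) = 1 := by
  rw [hf.2.1 x hx _ (inv_nonneg.2 (hf.1 x hx)), inv_mul_cancel₀ h]

/-- The point of minimal norm of `{f ≥ 1}` satisfies `‖y‖² ≤ f*(y)`. -/
theorem exists_norm_sq_le_dualAntinorm {d : ℕ} {f : EuclideanSpace ℝ (Fin d) → ℝ}
    (hf : IsAntinorm f) (hc : ContinuousOn f (pos d)) :
    ∃ y ∈ pos d, 1 ≤ f y ∧ ‖y‖ ^ 2 ≤ dualAntinorm f y := by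
  have hscale : ∀ x ∈ pos d, f x ≠ 0 → (f x)⁻¹ • x ∈ {x | x ∈ pos d ∧ 1 ≤ f x} := fun x hx h =>
    ⟨smul_mem_pos hx (inv_nonneg.2 (hf.1 x hx)), (hf.apply_inv_smul hx h).ge⟩
  obtain ⟨x₀, hx₀, hfx₀⟩ := hf.2.2.2
  have hclosed : IsClosed {x | x ∈ pos d ∧ 1 ≤ f x} :=
    hc.preimage_isClosed_of_isClosed (isClosed_pos d) isClosed_Ici
  have hconv : Convex ℝ {x | x ∈ pos d ∧ 1 ≤ f x} := hf.2.2.1.convex_ge 1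
  obtain ⟨y, hy, hmin⟩ := exists_norm_eq_iInf_of_complete_convex
    ⟨_, hscale x₀ hx₀ hfx₀.ne'⟩ hclosed.isComplete hconv 0
  have hvar := (norm_eq_iInf_iff_real_inner_le_zero hconv hy).1 hmin
  refine ⟨y, hy.1, hy.2, le_csInf ⟨_, x₀, ⟨hx₀, hfx₀.ne'⟩, rfl⟩ ?_⟩
  rintro _ ⟨x, ⟨hx, hfx⟩, rfl⟩
  have h := hvar _ (hscale x hx hfx)
  rw [zero_sub, inner_neg_left, inner_sub_right, real_inner_self_eq_norm_sq,
    real_inner_smul_right] at h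
  simp only [dot_eq_inner, div_eq_inv_mul]
  linarith

/-- For every continuous self-dual antinorm on `ℝ^d₊`, the antisphere
`{x ∈ ℝ^d₊ : f(x) = 1}` meets the Euclidean unit sphere in exactly one point. -/
theorem self_dual_antisphere_meets_sphere_once (d : ℕ)
    (f : EuclideanSpace ℝ (Fin d) → ℝ)
    (hf : IsAntinorm f) (hc : ContinuousOn f (pos d))
    (hsd : ∀ p ∈ pos d, dualAntinorm f p = f p) :
    ∃! x : EuclideanSpace ℝ (Fin d), x ∈ pos d ∧ f x = 1 ∧ ‖x‖ = 1 := by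
  have hmul : ∀ x ∈ pos d, ∀ y ∈ pos d, f x * f y ≤ inner ℝ x y := fun x hx y hy => by
    rw [← hsd x hx, ← dot_eq_inner]
    exact dualAntinorm_mul_le_dot hf hx hy
  obtain ⟨y, hy, h1, h2⟩ := exists_norm_sq_le_dualAntinorm hf hc
  rw [hsd y hy] at h2
  have h3 := hmul y hy y hy
  rw [real_inner_self_eq_norm_sq] at h3
  have hfy : f y = 1 := by nlinarith
  have hny : ‖y‖ = 1 := by
    rw [hfy] at h2 h3
    nlinarith [norm_nonneg y]
  refine ⟨y, ⟨hy, hfy, hny⟩, fun z hz => ?_⟩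
  obtain ⟨hz, hfz, hnz⟩ := hz
  have h4 := hmul z hz y hy
  rw [hfz, hfy, one_mul] at h4
  exact (inner_eq_one_iff_of_norm_eq_one hnz hny).1
    (h4.antisymm' (by simpa [hnz, hny] using real_inner_le_norm z y))
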